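/- Let p be a prime, let k ≥ 1 be an integer with p ∤ k, and let r, s be integers with 1 ≤ r < s. Set n = k·p^s. Then the p-adic valuation of the binomial coefficient C(n − 2, p^r − 1) equals r; that is, padicValNat p (Nat.choose (n - 2) (p^r - 1)) = r. -/

import Mathlib

/-- If `p ^ s ∣ n + 1`, no binomial coefficient `C(n, j)` with `j < p ^ s` is divisible by `p`. -/
theorem Nat.Prime.not_dvd_choose_of_pow_dvd_add_one {p s n : ℕ} (hp : p.Prime)
    (h : p ^ s ∣ n + 1) : ∀ j < p ^ s, ¬ p ∣ n.choose j
  | 0, _ => by simpa using hp.one_lt.ne'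
  | j + 1, hj => by
    have ih := hp.not_dvd_choose_of_pow_dvd_add_one h j (by omega)
    have hdvd : p ∣ (n + 1).choose (j + 1) := by
      by_contra hc
      have hmul : p ^ s ∣ (n + 1).choose (j + 1) * (j + 1) :=
        Nat.add_one_mul_choose_eq n j ▸ h.mul_right _
      have hcop : (p ^ s).Coprime ((n + 1).choose (j + 1)) :=
        ((hp.coprime_iff_not_dvd).2 hc).pow_left s
      exact absurd (Nat.le_of_dvd j.succ_pos (hcop.dvd_of_dvd_mul_left hmul)) (by omega)
    rw [Nat.choose_succ_succ'] at hdvd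
    exact fun hc => ih ((Nat.dvd_add_left hc).1 hdvd)


/-- For a prime `p`, `n = k·p^s` with `p ∤ k`, and `1 ≤ r < s`, the `p`-adic valuation of the
Dynkin index `C(n − 2, p^r − 1)` of the `p^r`-th exterior power of the tautological
representation of `SL_n` equals `r`. -/
theorem padicValNat_choose_sub_two
    (p k r s n : ℕ) (hp : p.Prime) (hk : 1 ≤ k) (hpk : ¬ p ∣ k)
    (hr : 1 ≤ r) (hrs : r < s) (hn : n = k * p ^ s) :
    padicValNat p (Nat.choose (n - 2) (p ^ r - 1)) = r := by
  have : Fact p.Prime := ⟨hp⟩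
  obtain ⟨d, rfl⟩ : ∃ d, s = r + (d + 1) := ⟨s - r - 1, by omega⟩
  have hpr : 1 < p ^ r := Nat.one_lt_pow (by omega) hp.one_lt
  obtain ⟨t, ht⟩ : ∃ t, k * p ^ (d + 1) = t + 1 :=
    ⟨k * p ^ (d + 1) - 1, by have := Nat.mul_pos hk (pow_pos hp.pos (d + 1)); omega⟩
  have hn' : n = p ^ r * (t + 1) := by rw [hn, ← ht]; ring
  have hpt : p ∣ t + 1 := ht ▸ (dvd_pow_self p d.succ_ne_zero).mul_left k
  have not_dvd_pred : ∀ m, p ∣ m + 1 → ¬ p ∣ m := fun m h h' =>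
    hp.one_lt.ne' (Nat.dvd_one.1 ((Nat.dvd_add_right h').1 h))
  have ht_not_dvd : ¬ p ∣ t := not_dvd_pred t hpt
  obtain ⟨m, rfl⟩ : ∃ m, n = m + 2 :=
    ⟨n - 2, by have := Nat.le_mul_of_pos_right (p ^ r) (Nat.add_one_pos t); omega⟩
  have hm_not_dvd : ¬ p ∣ m + 1 := not_dvd_pred (m + 1) (hn' ▸ hpt.mul_left _)
  have hc : ¬ p ∣ (m + 1).choose (p ^ r - 1) :=
    hp.not_dvd_choose_of_pow_dvd_add_one (s := r) ⟨t + 1, hn'⟩ _ (by omega)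
  have hsub : m + 1 - (p ^ r - 1) = p ^ r * t := by
    rw [mul_add_one] at hn'
    omega
  have key := Nat.choose_mul_succ_eq m (p ^ r - 1)
  rw [hsub] at key
  have ht0 : t ≠ 0 := by rintro rfl; simp at ht_not_dvd
  have hc0 : (m + 1).choose (p ^ r - 1) ≠ 0 := by intro h; simp [h] at hc
  have hm0 : m.choose (p ^ r - 1) ≠ 0 := by
    intro h
    simp [h, hc0, ht0, hp.ne_zero] at key
  have hval := congrArg (padicValNat p) key
  rw [padicValNat.mul hm0 m.succ_ne_zero, padicValNat.mul hc0 (by positivity),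
    padicValNat.mul (by positivity) ht0, padicValNat.prime_pow,
    padicValNat.eq_zero_of_not_dvd hm_not_dvd, padicValNat.eq_zero_of_not_dvd hc,
    padicValNat.eq_zero_of_not_dvd ht_not_dvd] at hval
  simpa using hval
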